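/- Let W = W_1^n be an upward primitive disk word with n > 2. Then the set {i : 1 < i < n and h(x_i) = 1} is nonempty; writing its elements in increasing order as k_1 < k_2 < ... < k_{d+1}, one has k_1 = 2, k_{d+1} = n-1, d >= 1, and for each 1 <= i <= d the subword W_{k_i}^{k_{i+1}} is a primitive disk word. (This is the decomposition used in Step II(b) of the paper's algorithm: the height-one X-letters cut an upward primitive disk word into primitive disk words.) -/

import Mathlib

/-- A letter of the alphabet `{X, X⁻¹, Y, Y⁻¹}`. -/
inductive L where
  | X | Xi | Y | Yi
deriving DecidableEq

/-- A word is a finite sequence of letters. -/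
abbrev Word := List L

/-- Whether a letter is an `X`-letter, i.e. `X` or `X⁻¹`. -/
def L.isX : L → Bool
  | .X => true
  | .Xi => true
  | _ => false

/-- The sign of a letter: `+1` for `X`, `-1` for `X⁻¹`, `0` for `Y`-letters. -/
def L.sgn : L → ℤ
  | .X => 1
  | .Xi => -1
  | _ => 0

/-- The formal inverse of a letter. -/
def L.inv : L → L
  | .X => .Xi
  | .Xi => .X
  | .Y => .Yi
  | .Yi => .Y

/-- `phi W` = (number of `X`'s in `W`) - (number of `X⁻¹`'s in `W`). -/
def phi (w : Word) : ℤ := (w.map L.sgn).sum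

/-- The subsequence of `X`-letters `x₁, …, xₙ` of a word. -/
def xLetters (w : Word) : Word := w.filter (·.isX)

/-- The number `n` of `X`-letters of a word. -/
def numX (w : Word) : ℕ := (xLetters w).length

/-- The `i`-th `X`-letter `xᵢ` of a word (1-indexed; junk value `Y` out of range). -/
def xLtr (w : Word) (i : ℕ) : L := (xLetters w).getD (i - 1) L.Y

/-- `phi (W₁ⁱ)`: the sign-sum of the first `i` `X`-letters of `W`. -/
def phiPrefix (w : Word) (i : ℕ) : ℤ := (((xLetters w).take i).map L.sgn).sum

/-- `W` is a disk word: it has `n ≥ 2` `X`-letters, its first letter is `x₁`,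
its last letter is `xₙ`, `x₁` and `xₙ` have opposite signs, and `phi W = 0`. -/
def IsDiskWord (w : Word) : Prop :=
  2 ≤ numX w ∧
  w.head? = (xLetters w).head? ∧
  w.getLast? = (xLetters w).getLast? ∧
  phi w = 0 ∧
  (xLtr w 1).sgn = -(xLtr w (numX w)).sgn

/-- A disk word `W = W₁ⁿ` is primitive if `phi (W₁ᵏ) ≠ 0` for all `1 < k < n`. -/
def IsPrimitive (w : Word) : Prop :=
  IsDiskWord w ∧ ∀ k, 1 < k → k < numX w → phiPrefix w k ≠ 0

/-- A disk word is upward if `x₁ = X`. -/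
def Upward (w : Word) : Prop := xLtr w 1 = L.X

/-- A disk word is downward if `x₁ = X⁻¹`. -/
def Downward (w : Word) : Prop := xLtr w 1 = L.Xi

/-- `eps W i = 1` if `xᵢ` has the same sign as `x₁`, and `0` otherwise. -/
def eps (w : Word) (i : ℕ) : ℤ := if xLtr w i = xLtr w 1 then 1 else 0

/-- The height `h(xᵢ)`: `phi (W₁ⁱ) - eps xᵢ` in the upward case and
`phi (W₁ⁱ) + eps xᵢ` in the downward case. -/
def height (w : Word) (i : ℕ) : ℤ :=
  if xLtr w 1 = L.X then phiPrefix w i - eps w i else phiPrefix w i + eps w i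

/-- A word is reduced if it has no adjacent pair of mutually inverse letters. -/
def Reduced (w : Word) : Prop := w.Chain' (fun a b => b ≠ a.inv)

/-- The (0-indexed) positions in `w` of its `X`-letters. -/
def xPos (w : Word) : List ℕ :=
  (List.range w.length).filter (fun i => (w.getD i L.Y).isX)

/-- `subword w i j` = `Wᵢʲ`, the contiguous subword of `w` from the `i`-th
to the `j`-th `X`-letter (1-indexed, inclusive). -/
def subword (w : Word) (i j : ℕ) : Word :=
  (w.take ((xPos w).getD (j - 1) 0 + 1)).drop ((xPos w).getD (i - 1) 0)

/-- `Y^m`: `m` copies of `Y` if `m ≥ 0`, `-m` copies of `Y⁻¹` if `m < 0`. -/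
def Ypow (m : ℤ) : Word :=
  if 0 ≤ m then List.replicate m.toNat L.Y else List.replicate (-m).toNat L.Yi


/-- The increasing list of indices `i` with `1 < i < n` and `h(xᵢ) = 1`. -/
def heightOnes (w : Word) : List ℕ :=
  (List.range (numX w)).filter (fun i => decide (1 < i ∧ i < numX w ∧ height w i = 1))

theorem xPos_cons (a : L) (w : Word) :
    xPos (a :: w) = (if a.isX then [0] else []) ++ (xPos w).map Nat.succ := by
  unfold xPos
  rw [List.length_cons, List.range_succ_eq_map, List.filter_cons, List.filter_map]
  cases h : a.isX <;> simp [h, Function.comp_def]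

theorem length_xPos (w : Word) : (xPos w).length = numX w := by
  induction w with
  | nil => rfl
  | cons a w ih =>
    rw [xPos_cons]
    unfold numX xLetters at *
    cases h : a.isX <;> simp [h, ih]

/-- The `i`-th (0-indexed) position of an `X`-letter carries the `i`-th `X`-letter, and the word
before it contains exactly the previous `X`-letters. -/
theorem xPos_spec (w : Word) (i : ℕ) (hi : i < numX w) :
    w[(xPos w).getD i 0]? = (xLetters w)[i]? ∧
      xLetters (w.take ((xPos w).getD i 0)) = (xLetters w).take i := by
  induction w generalizing i with
  | nil => simp [numX, xLetters] at hi
  | cons a w ih =>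
    have hl := length_xPos w
    rw [xPos_cons]
    cases h : a.isX
    · have hi' : i < numX w := by simpa [numX, xLetters, h] using hi
      have := ih i hi'
      rw [List.getD_eq_getElem _ _ (by omega)] at this
      simpa [xLetters, h, hl, hi'] using this
    · cases i with
      | zero => simp [xLetters, h]
      | succ i =>
        have hi' : i < numX w := by simpa [numX, xLetters, h] using hi
        have := ih i hi'
        rw [List.getD_eq_getElem _ _ (by omega)] at this
        simpa [xLetters, h, hl, hi'] using this

theorem xLetters_append (u v : Word) : xLetters (u ++ v) = xLetters u ++ xLetters v :=
  List.filter_append ..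

theorem xLetters_take_succ_xPos (w : Word) (i : ℕ) (hi : i < numX w) :
    xLetters (w.take ((xPos w).getD i 0 + 1)) = (xLetters w).take (i + 1) := by
  obtain ⟨h1, h2⟩ := xPos_spec w i hi
  have hx : ((xLetters w)[i]'hi).isX = true := by
    have := List.getElem_mem (l := xLetters w) (n := i) hi
    exact (List.mem_filter.1 this).2
  rw [List.take_add_one, List.take_add_one, xLetters_append, h2, h1]
  rw [List.getElem?_eq_getElem hi]
  generalize (xLetters w)[i]'hi = x at *
  simp [xLetters, hx]

theorem xPos_getD_le (w : Word) {i j : ℕ} (hij : i ≤ j) (hj : j < numX w) :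
    (xPos w).getD i 0 ≤ (xPos w).getD j 0 := by
  by_contra! h
  have h1 := xLetters_take_succ_xPos w j hj
  have h2 := (xPos_spec w i (by omega)).2
  have h3 : (w.take ((xPos w).getD j 0 + 1)).Sublist (w.take ((xPos w).getD i 0)) :=
    (List.take_prefix_take_left (by omega)).sublist
  have h4 := (h3.filter (·.isX)).length_le
  change (xLetters _).length ≤ (xLetters _).length at h4
  rw [h1, h2, List.length_take, List.length_take] at h4
  unfold numX at hj
  omega

theorem xLetters_subword (w : Word) {i j : ℕ} (hi : 1 ≤ i) (hij : i ≤ j) (hj : j ≤ numX w) :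
    xLetters (subword w i j) = ((xLetters w).take j).drop (i - 1) := by
  have hle := xPos_getD_le w (i := i - 1) (j := j - 1) (by omega) (by omega)
  have h1 := xLetters_take_succ_xPos w (j - 1) (by omega)
  have h2 := (xPos_spec w (i - 1) (by omega)).2
  unfold subword
  generalize (xPos w).getD (i - 1) 0 = p at *
  generalize (xPos w).getD (j - 1) 0 = q at *
  have h3 := congrArg xLetters (List.take_append_drop p (w.take (q + 1)))
  rw [xLetters_append, List.take_take, min_eq_left (by omega), h1, h2,
    Nat.sub_add_cancel (by omega)] at h3
  rw [← h3, List.drop_left']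
  rw [List.length_take]
  unfold numX at hj
  omega

theorem head?_subword (w : Word) {i j : ℕ} (hi : 1 ≤ i) (hij : i ≤ j) (hj : j ≤ numX w) :
    (subword w i j).head? = (xLetters (subword w i j)).head? := by
  rw [xLetters_subword w hi hij hj]
  have hle := xPos_getD_le w (i := i - 1) (j := j - 1) (by omega) (by omega)
  have h1 := (xPos_spec w (i - 1) (by omega)).1
  unfold subword
  rw [List.head?_drop, List.head?_drop, List.getElem?_take_of_lt (by omega),
    List.getElem?_take_of_lt (by omega), h1]

theorem getLast?_subword (w : Word) {i j : ℕ} (hi : 1 ≤ i) (hij : i ≤ j) (hj : j ≤ numX w) :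
    (subword w i j).getLast? = (xLetters (subword w i j)).getLast? := by
  rw [xLetters_subword w hi hij hj]
  have hle := xPos_getD_le w (i := i - 1) (j := j - 1) (by omega) (by omega)
  have h1 := (xPos_spec w (j - 1) (by omega)).1
  have hlt : (xPos w).getD (j - 1) 0 < w.length := by
    by_contra! h
    rw [List.getElem?_eq_none h, List.getElem?_eq_getElem (by unfold numX at hj; omega)] at h1
    cases h1
  unfold subword
  unfold numX at hj
  rw [List.getLast?_drop, List.getLast?_drop, if_neg (by rw [List.length_take]; omega),
    if_neg (by rw [List.length_take]; omega),
    List.getLast?_eq_getElem?, List.getLast?_eq_getElem?, List.length_take, List.length_take,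
    min_eq_left (by omega), min_eq_left hj, Nat.add_sub_cancel,
    List.getElem?_take_of_lt (by omega), List.getElem?_take_of_lt (by omega), h1]

theorem phi_eq_phiPrefix (w : Word) : phi w = phiPrefix w (numX w) := by
  unfold phiPrefix numX
  rw [List.take_length]
  induction w with
  | nil => rfl
  | cons a w ih => cases a <;> simp_all [phi, xLetters, L.isX, L.sgn]

theorem phiPrefix_zero (w : Word) : phiPrefix w 0 = 0 := by simp [phiPrefix]

theorem xLtr_cases (w : Word) {i : ℕ} (hi : 1 ≤ i) (hn : i ≤ numX w) :
    xLtr w i = L.X ∨ xLtr w i = L.Xi := by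
  unfold xLtr
  unfold numX at hn
  rw [List.getD_eq_getElem _ _ (by omega)]
  have := List.getElem_mem (l := xLetters w) (n := i - 1) (by omega)
  have := (List.mem_filter.1 this).2
  generalize (xLetters w)[i - 1]'(by omega) = a at *
  cases a <;> simp_all [L.isX]

theorem phiPrefix_succ (w : Word) {i : ℕ} (hn : i < numX w) :
    phiPrefix w (i + 1) = phiPrefix w i + (xLtr w (i + 1)).sgn := by
  unfold numX at hn
  rw [phiPrefix, phiPrefix, xLtr, List.take_add_one, Nat.add_sub_cancel,
    List.getD_eq_getElem _ _ hn, List.getElem?_eq_getElem hn, List.map_append, List.sum_append]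
  simp

theorem phiPrefix_subword (w : Word) {i j k : ℕ} (hi : 1 ≤ i) (hij : i ≤ j) (hj : j ≤ numX w)
    (hk : i - 1 + k ≤ j) :
    phiPrefix (subword w i j) k = phiPrefix w (i - 1 + k) - phiPrefix w (i - 1) := by
  unfold phiPrefix
  rw [xLetters_subword w hi hij hj, List.take_add (i := i - 1), List.map_append, List.sum_append,
    List.drop_take, List.take_take, min_eq_left (by omega)]
  ring

theorem numX_subword (w : Word) {i j : ℕ} (hi : 1 ≤ i) (hij : i ≤ j) (hj : j ≤ numX w) :
    numX (subword w i j) = j + 1 - i := by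
  rw [numX, xLetters_subword w hi hij hj]
  unfold numX at hj
  simp
  omega

theorem xLtr_subword (w : Word) {i j k : ℕ} (hi : 1 ≤ i) (hij : i ≤ j) (hj : j ≤ numX w)
    (hk : 1 ≤ k) (hkj : i - 1 + k ≤ j) :
    xLtr (subword w i j) k = xLtr w (i - 1 + k) := by
  unfold xLtr
  rw [xLetters_subword w hi hij hj, List.getD_eq_getElem?_getD, List.getD_eq_getElem?_getD,
    List.getElem?_drop, List.getElem?_take_of_lt (by omega)]
  congr 3
  omega

/-- The subword between two `X`-letters is a primitive disk word when the partial sums of signs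
return to their initial value exactly at its end. -/
theorem isPrimitive_subword (w : Word) {i j : ℕ} (hi : 1 ≤ i) (hij : i < j) (hj : j ≤ numX w)
    (hsgn : (xLtr w i).sgn = -(xLtr w j).sgn)
    (hend : phiPrefix w j = phiPrefix w (i - 1))
    (hmid : ∀ k, i < k → k < j → phiPrefix w k ≠ phiPrefix w (i - 1)) :
    IsPrimitive (subword w i j) := by
  have hn := numX_subword w hi hij.le hj
  refine ⟨⟨by omega, head?_subword w hi hij.le hj, getLast?_subword w hi hij.le hj, ?_, ?_⟩, ?_⟩
  · rw [phi_eq_phiPrefix, hn, phiPrefix_subword w hi hij.le hj (by omega),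
      show i - 1 + (j + 1 - i) = j by omega, hend, sub_self]
  · rw [hn, xLtr_subword w hi hij.le hj le_rfl (by omega),
      xLtr_subword w hi hij.le hj (by omega) (by omega),
      show i - 1 + (j + 1 - i) = j by omega, show i - 1 + 1 = i by omega, hsgn]
  · intro k hk hkn
    rw [phiPrefix_subword w hi hij.le hj (by omega)]
    exact sub_ne_zero.2 (hmid _ (by omega) (by omega))

/-- In an upward word each `X`-letter is either an up-step starting at its height or a down-step
ending at its height. -/
theorem step_cases {w : Word} (hup : Upward w) {i : ℕ} (hi : 1 ≤ i) (hn : i ≤ numX w) :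
    ((xLtr w i).sgn = 1 ∧ phiPrefix w (i - 1) = height w i ∧
      phiPrefix w i = height w i + 1) ∨
    ((xLtr w i).sgn = -1 ∧ phiPrefix w (i - 1) = height w i + 1 ∧
      phiPrefix w i = height w i) := by
  obtain ⟨i, rfl⟩ : ∃ k, i = k + 1 := ⟨i - 1, by omega⟩
  have hs := phiPrefix_succ w (i := i) (by omega)
  unfold Upward at hup
  rcases xLtr_cases w hi hn with h | h <;>
    simp [height, eps, hup, h, L.sgn] at hs ⊢ <;> omega

theorem IsPrimitive.phiPrefix_pos {w : Word} (hw : IsPrimitive w) (hup : Upward w) {i : ℕ}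
    (hi : 1 ≤ i) (hn : i < numX w) : 0 < phiPrefix w i := by
  induction i, hi using Nat.le_induction with
  | base =>
    have h := phiPrefix_succ w (i := 0) (by omega)
    rw [phiPrefix_zero, zero_add, zero_add, hup] at h
    simp [h, L.sgn]
  | succ i hi ih =>
    have h0 := hw.2 (i + 1) (by omega) hn
    have h1 := ih (by omega)
    have h2 := step_cases hup (i := i + 1) (by omega) hn.le
    rw [Nat.add_sub_cancel] at h2
    omega

theorem IsPrimitive.height_two {w : Word} (hw : IsPrimitive w) (hup : Upward w)
    (hn : 2 < numX w) : height w 2 = 1 := by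
  have h0 := phiPrefix_zero w
  have h1 := step_cases hup (i := 1) le_rfl (by omega)
  have h2 := step_cases hup (i := 2) (by omega) hn.le
  have p1 := hw.phiPrefix_pos hup (i := 1) le_rfl (by omega)
  have p2 := hw.phiPrefix_pos hup (i := 2) (by omega) hn
  simp only [Nat.sub_self, Nat.reduceSub] at h1 h2
  omega

theorem IsPrimitive.height_pred {w : Word} (hw : IsPrimitive w) (hup : Upward w)
    (hn : 2 < numX w) : height w (numX w - 1) = 1 := by
  have h0 := (phi_eq_phiPrefix w).symm.trans hw.1.2.2.2.1
  have h1 := step_cases hup (i := numX w) (by omega) le_rfl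
  have h2 := step_cases hup (i := numX w - 1) (by omega) (by omega)
  have p1 := hw.phiPrefix_pos hup (i := numX w - 1) (by omega) (by omega)
  have p2 := hw.phiPrefix_pos hup (i := numX w - 1 - 1) (by omega) (by omega)
  omega

theorem IsPrimitive.numX_ne_three {w : Word} (hw : IsPrimitive w) (hup : Upward w) :
    numX w ≠ 3 := by
  intro hn
  have h0 := (phi_eq_phiPrefix w).symm.trans hw.1.2.2.2.1
  have h1 := step_cases hup (i := 3) (by omega) hn.ge
  have h2 := step_cases hup (i := 2) (by omega) (by omega)
  have h3 := hw.height_two hup (by omega)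
  rw [hn] at h0
  simp only [Nat.reduceSub] at h1 h2
  have h4 := hw.phiPrefix_pos hup (i := 1) le_rfl (by omega)
  have h5 := step_cases hup (i := 1) le_rfl (by omega)
  have h6 := phiPrefix_zero w
  simp only [Nat.sub_self] at h5
  omega

/-- Consecutive height-one letters of an upward primitive disk word bound a primitive disk word. -/
theorem IsPrimitive.subword_of_consecutive {w : Word} (hw : IsPrimitive w) (hup : Upward w)
    {i j : ℕ} (hi : 1 < i) (hij : i < j) (hj : j < numX w) (hhi : height w i = 1)
    (hhj : height w j = 1) (hmid : ∀ k, i < k → k < j → height w k ≠ 1) :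
    IsPrimitive (subword w i j) := by
  have hsi := step_cases hup (i := i) (by omega) (by omega)
  have hsj := step_cases hup (i := j) (by omega) (by omega)
  have key : ∀ k, i ≤ k → k < j → (phiPrefix w i ≤ 1 ↔ phiPrefix w k ≤ 1) := by
    intro k hk
    induction k, hk using Nat.le_induction with
    | base => intro _; rfl
    | succ k hk ih =>
      intro hkj
      have h1 := ih (by omega)
      have h2 := step_cases hup (i := k + 1) (by omega) (by omega)
      have h3 := hmid (k + 1) (by omega) hkj
      rw [Nat.add_sub_cancel] at h2
      omega
  have hlast := key (j - 1) (by omega) (by omega)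
  refine isPrimitive_subword w (by omega) hij hj.le (by omega) (by omega) ?_
  intro k hk hkj
  have h1 := key k hk.le hkj
  have h2 := hw.phiPrefix_pos hup (i := k) (by omega) (by omega)
  omega

theorem mem_heightOnes {w : Word} {i : ℕ} :
    i ∈ heightOnes w ↔ 1 < i ∧ i < numX w ∧ height w i = 1 := by
  simp only [heightOnes, List.mem_filter, List.mem_range, decide_eq_true_eq]
  tauto

theorem heightOnes_pairwise (w : Word) : (heightOnes w).Pairwise (· < ·) :=
  List.pairwise_lt_range.filter _

theorem head?_eq_some_of_le {l : List ℕ} (hl : l.Pairwise (· < ·)) {a : ℕ} (ha : a ∈ l)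
    (hmin : ∀ b ∈ l, a ≤ b) : l.head? = some a := by
  cases l with
  | nil => simp at ha
  | cons b l =>
    have h1 := hmin b (by simp)
    rw [List.pairwise_cons] at hl
    rcases List.mem_cons.1 ha with rfl | h
    · rfl
    · have := hl.1 a h
      omega

theorem getLast?_eq_some_of_le {l : List ℕ} (hl : l.Pairwise (· < ·)) {a : ℕ} (ha : a ∈ l)
    (hmax : ∀ b ∈ l, b ≤ a) : l.getLast? = some a := by
  induction l using List.reverseRecOn with
  | nil => simp at ha
  | append_singleton l b =>
    have h1 := hmax b (by simp)
    rw [List.pairwise_append] at hl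
    rcases List.mem_append.1 ha with h | h
    · have := hl.2.2 a h b (by simp)
      omega
    · simp_all

theorem notMem_of_getElem_lt_of_lt_getElem {l : List ℕ} (hl : l.Pairwise (· < ·)) {i k : ℕ}
    (hi : i + 1 < l.length) (h1 : l[i] < k) (h2 : k < l[i + 1]) : k ∉ l := by
  intro hk
  obtain ⟨m, hm, rfl⟩ := List.getElem_of_mem hk
  have hs : StrictMono l.get := List.pairwise_iff_get.1 hl
  have h3 := hs.lt_iff_lt (a := ⟨i, by omega⟩) (b := ⟨m, hm⟩) |>.1 h1
  have h4 := hs.lt_iff_lt (a := ⟨m, hm⟩) (b := ⟨i + 1, hi⟩) |>.1 h2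
  simp only [Fin.mk_lt_mk] at h3 h4
  omega

/-- for an upward primitive disk word with `n > 2` `X`-letters, the
increasing list `k₁ < … < k_{d+1}` of interior height-one indices is nonempty, starts
at `2`, ends at `n - 1`, has at least two entries (`d ≥ 1`), and each subword
`W_{kᵢ}^{k_{i+1}}` is a primitive disk word. -/
theorem heightOne_decomposition (w : Word) (hw : IsPrimitive w) (hup : Upward w)
    (hn : 2 < numX w) :
    heightOnes w ≠ [] ∧
    (heightOnes w).head? = some 2 ∧
    (heightOnes w).getLast? = some (numX w - 1) ∧
    2 ≤ (heightOnes w).length ∧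
    (∀ i, i + 1 < (heightOnes w).length →
      IsPrimitive (subword w ((heightOnes w).getD i 0) ((heightOnes w).getD (i + 1) 0))) := by
  have h2 : 2 ∈ heightOnes w := mem_heightOnes.2 ⟨by omega, hn, hw.height_two hup hn⟩
  have hpred : numX w - 1 ∈ heightOnes w :=
    mem_heightOnes.2 ⟨by omega, by omega, hw.height_pred hup hn⟩
  have hsorted := heightOnes_pairwise w
  refine ⟨List.ne_nil_of_mem h2, head?_eq_some_of_le hsorted h2 ?_,
    getLast?_eq_some_of_le hsorted hpred ?_, ?_, ?_⟩
  · intro b hb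
    exact (mem_heightOnes.1 hb).1
  · intro b hb
    have := (mem_heightOnes.1 hb).2.1
    omega
  · have hne := hw.numX_ne_three hup
    by_contra! hlen
    obtain ⟨a, ha⟩ := List.length_eq_one_iff.1
      (show (heightOnes w).length = 1 by have := List.length_pos_of_mem h2; omega)
    rw [ha, List.mem_singleton] at h2 hpred
    omega
  · intro i hi
    rw [List.getD_eq_getElem _ _ (by omega), List.getD_eq_getElem _ _ hi]
    obtain ⟨ha1, -, ha⟩ :=
      mem_heightOnes.1 (List.getElem_mem (l := heightOnes w) (n := i) (by omega))
    obtain ⟨-, hb1, hb⟩ := mem_heightOnes.1 (List.getElem_mem hi)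
    have hlt := List.pairwise_iff_getElem.1 hsorted i (i + 1) (by omega) hi (by omega)
    refine hw.subword_of_consecutive hup ha1 hlt hb1 ha hb fun k hk1 hk2 hk => ?_
    exact notMem_of_getElem_lt_of_lt_getElem hsorted hi hk1 hk2
      (mem_heightOnes.2 ⟨by omega, by omega, hk⟩)
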